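/- Fix T ∈ T_{λ,μ} and σ ∈ S_n with f(σ) = T, and let (h,k) be uniformly distributed on the stabilizer (S_λ × S_μ)_σ = {(h,k) : h⁻¹ σ k = σ}. For each (i,j), let a_{i,j} = (a^{(l)}_{i,j})_{l≥1} where a^{(l)}_{i,j} is the number of l-cycles of h contained in L_i ∩ σ(M_j). Then each a_{i,j} is distributed as the cycle type of a uniformly random permutation of a set of size T_{i,j}, and the random vectors (a_{i,j})_{i,j} are mutually independent. -/

import Mathlib

/-- The sum of the block sizes before index `i`. -/
def blockOffset {I : ℕ} (lam : Fin I → ℕ) (i : Fin I) : ℕ :=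
  ∑ i' ∈ Finset.univ.filter (fun i' : Fin I => i' < i), lam i'

/-- The `i`-th consecutive block `L_i` of `{1,…,n}` (realized as `Fin n`) for the
composition `lam`. -/
def blockF (n : ℕ) {I : ℕ} (lam : Fin I → ℕ) (i : Fin I) : Finset (Fin n) :=
  Finset.univ.filter (fun x : Fin n =>
    blockOffset lam i ≤ (x : ℕ) ∧ (x : ℕ) < blockOffset lam i + lam i)

/-- The Young (parabolic) subgroup `S_λ = {σ : σ(L_i) = L_i for all i}`. -/
def young (n : ℕ) {I : ℕ} (lam : Fin I → ℕ) : Set (Equiv.Perm (Fin n)) :=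
  {σ | ∀ i : Fin I, (blockF n lam i).image ⇑σ = blockF n lam i}

/-- The contingency table `f(σ)_{i,j} = |L_i ∩ σ(M_j)|`. -/
def tab (n : ℕ) {I J : ℕ} (lam : Fin I → ℕ) (mu : Fin J → ℕ) (σ : Equiv.Perm (Fin n)) :
    Fin I → Fin J → ℕ :=
  fun i j => (blockF n lam i ∩ (blockF n mu j).image ⇑σ).card

/-- The cycle of the permutation `h` containing `x`, identified with its support set
(fixed points count as 1-cycles).  Since every cycle has length at most `n`, the orbit
of `x` under the powers of `h` is `{h^m x : m < n}`. -/
def permOrbit {n : ℕ} (h : Equiv.Perm (Fin n)) (x : Fin n) : Finset (Fin n) :=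
  (Finset.range n).image (fun m => (h ^ m) x)

/-- The set of cycles of a permutation, each identified with its support set. -/
def permCycles {n : ℕ} (h : Equiv.Perm (Fin n)) : Finset (Finset (Fin n)) :=
  Finset.univ.image (permOrbit h)

/-- `cycCount h l` is the number of `l`-cycles of `h`; the function `l ↦ cycCount h l`
is the cycle type of `h`. -/
def cycCount {n : ℕ} (h : Equiv.Perm (Fin n)) (l : ℕ) : ℕ :=
  ((permCycles h).filter (fun C => C.card = l)).card

/-- `a^{(l)}_{i,j}`: the number of `l`-cycles of `h` contained in `L_i ∩ σ(M_j)`. -/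
def meetCycCount (n : ℕ) {I J : ℕ} (lam : Fin I → ℕ) (mu : Fin J → ℕ)
    (σ h : Equiv.Perm (Fin n)) (l : ℕ) (i : Fin I) (j : Fin J) : ℕ :=
  ((permCycles h).filter (fun C =>
    C.card = l ∧ C ⊆ blockF n lam i ∩ (blockF n mu j).image ⇑σ)).card

lemma mem_permOrbit_iff_sameCycle {n : ℕ} (h : Equiv.Perm (Fin n)) (x y : Fin n) :
    y ∈ permOrbit h x ↔ h.SameCycle x y := by
  simp only [permOrbit, Finset.mem_image, Finset.mem_range]
  constructor
  · rintro ⟨m, -, rfl⟩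
    exact ⟨m, by simp⟩
  · intro hxy
    obtain ⟨m, rfl⟩ := hxy.exists_nat_pow_eq
    have hper : Function.IsPeriodicPt h (Function.minimalPeriod h x) x :=
      Function.isPeriodicPt_minimalPeriod h x
    have hpos : 0 < Function.minimalPeriod h x :=
      Function.minimalPeriod_pos_of_mem_periodicPts
        (h.injective.mem_periodicPts x)
    refine ⟨m % Function.minimalPeriod h x, (Nat.mod_lt _ hpos).trans_le ?_, ?_⟩
    · simpa using Function.minimalPeriod_le_card (f := h) (x := x)
    · simp only [Equiv.Perm.coe_pow]
      exact Function.iterate_mod_minimalPeriod_eq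

lemma permOrbit_eq_image {m n : ℕ} {h : Equiv.Perm (Fin n)} {π : Equiv.Perm (Fin m)}
    (e : Fin m → Fin n) (he : Function.Semiconj e π h) (y : Fin m) :
    permOrbit h (e y) = (permOrbit π y).image e := by
  have hpow (k : ℕ) (z : Fin m) : e ((π ^ k) z) = (h ^ k) (e z) := by
    simpa only [Equiv.Perm.coe_pow] using he.iterate_right k z
  ext x
  rw [mem_permOrbit_iff_sameCycle]
  simp only [Finset.mem_image, mem_permOrbit_iff_sameCycle]
  constructor
  · intro hx
    obtain ⟨k, rfl⟩ := hx.exists_nat_pow_eq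
    exact ⟨(π ^ k) y, ⟨k, by simp⟩, hpow k y⟩
  · rintro ⟨z, hz, rfl⟩
    obtain ⟨k, rfl⟩ := hz.exists_nat_pow_eq
    exact ⟨k, by simp [hpow]⟩

lemma self_mem_permOrbit {n : ℕ} (h : Equiv.Perm (Fin n)) (x : Fin n) : x ∈ permOrbit h x :=
  (mem_permOrbit_iff_sameCycle h x x).2 (Equiv.Perm.SameCycle.refl h x)

/-- The cycles of `h` inside an invariant set correspond to the cycles of the restriction of `h`. -/
lemma card_permCycles_filter_subset {m n : ℕ} {h : Equiv.Perm (Fin n)} {π : Equiv.Perm (Fin m)}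
    {S : Finset (Fin n)} (e : Fin m → Fin n) (he : Function.Semiconj e π h)
    (hinj : Function.Injective e) (hS : ∀ x, x ∈ S ↔ ∃ y, e y = x) (l : ℕ) :
    ((permCycles h).filter (fun C => C.card = l ∧ C ⊆ S)).card = cycCount π l := by
  rw [cycCount, ← Finset.card_image_of_injective _ (Finset.image_injective hinj)]
  congr 1
  ext C
  simp only [permCycles, Finset.mem_filter, Finset.mem_image, Finset.mem_univ, true_and]
  constructor
  · rintro ⟨⟨x, rfl⟩, hl, hsub⟩
    obtain ⟨y, rfl⟩ := (hS x).1 (hsub (self_mem_permOrbit h x))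
    rw [permOrbit_eq_image e he, Finset.card_image_of_injective _ hinj] at hl
    exact ⟨_, ⟨⟨y, rfl⟩, hl⟩, (permOrbit_eq_image e he y).symm⟩
  · rintro ⟨_, ⟨⟨y, rfl⟩, hl⟩, rfl⟩
    refine ⟨⟨e y, permOrbit_eq_image e he y⟩, ?_, ?_⟩
    · rw [Finset.card_image_of_injective _ hinj, hl]
    · intro x hx
      obtain ⟨z, -, rfl⟩ := Finset.mem_image.1 hx
      exact (hS _).2 ⟨z, rfl⟩

/-- The permutations preserving a colouring are the families of permutations of its fibres. -/
def permFiberEquiv {α κ : Type*} (c : α → κ) :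
    {h : Equiv.Perm α // ∀ x, c (h x) = c x} ≃ ∀ q, Equiv.Perm {x // c x = q} where
  toFun h q := h.1.subtypePerm (fun x => by rw [h.2])
  invFun g := ⟨(Equiv.sigmaFiberEquiv c).symm.trans
    ((Equiv.sigmaCongrRight g).trans (Equiv.sigmaFiberEquiv c)), fun x => (g (c x) ⟨x, rfl⟩).2⟩
  left_inv h := by
    ext x
    rfl
  right_inv g := by
    ext q ⟨x, rfl⟩
    rfl

lemma blockOffset_add_le {I : ℕ} (lam : Fin I → ℕ) {i i' : Fin I} (hi : i < i') :
    blockOffset lam i + lam i ≤ blockOffset lam i' := by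
  rw [blockOffset, blockOffset, add_comm, ← Finset.sum_insert (by simp)]
  refine Finset.sum_le_sum_of_subset fun a ha => ?_
  simp only [Finset.mem_insert, Finset.mem_filter, Finset.mem_univ, true_and] at ha ⊢
  rcases ha with rfl | ha
  exacts [hi, ha.trans hi]

lemma blockF_index_unique {n I : ℕ} {lam : Fin I → ℕ} {x : Fin n} {i i' : Fin I}
    (hi : x ∈ blockF n lam i) (hi' : x ∈ blockF n lam i') : i = i' := by
  simp only [blockF, Finset.mem_filter, Finset.mem_univ, true_and] at hi hi'
  rcases lt_trichotomy i i' with hlt | heq | hlt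
  · have := blockOffset_add_le lam hlt
    omega
  · exact heq
  · have := blockOffset_add_le lam hlt
    omega

lemma mem_young_iff {n I : ℕ} {lam : Fin I → ℕ} {c : Fin n → Fin I}
    (hc : ∀ x i, x ∈ blockF n lam i ↔ c x = i) (h : Equiv.Perm (Fin n)) :
    h ∈ young n lam ↔ ∀ x, c (h x) = c x := by
  constructor
  · intro hh x
    rw [← hc, ← hh (c x)]
    exact Finset.mem_image_of_mem _ ((hc _ _).2 rfl)
  · intro hh i
    refine Finset.eq_of_subset_of_card_le (fun y hy => ?_)
      (Finset.card_image_of_injective _ h.injective).ge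
    obtain ⟨x, hx, rfl⟩ := Finset.mem_image.1 hy
    rw [hc, hh]
    exact (hc _ _).1 hx

lemma mem_image_perm_iff {n : ℕ} (σ : Equiv.Perm (Fin n)) (S : Finset (Fin n)) (x : Fin n) :
    x ∈ S.image ⇑σ ↔ σ⁻¹ x ∈ S := by
  rw [Finset.mem_image]
  constructor
  · rintro ⟨y, hy, rfl⟩
    simpa using hy
  · exact fun hx => ⟨_, hx, by simp⟩

/-- The blocks `L_i ∩ σ(M_j)` cover `Fin n` as soon as their sizes add up to `n`. -/
lemma exists_mem_meet {n I J : ℕ} {lam : Fin I → ℕ} {mu : Fin J → ℕ} {σ : Equiv.Perm (Fin n)}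
    (hsum : ∑ i, ∑ j, tab n lam mu σ i j = n) (x : Fin n) :
    ∃ i j, x ∈ blockF n lam i ∧ σ⁻¹ x ∈ blockF n mu j := by
  let S : Fin I × Fin J → Finset (Fin n) :=
    fun q => blockF n lam q.1 ∩ (blockF n mu q.2).image ⇑σ
  have hdisj : (↑(Finset.univ : Finset (Fin I × Fin J)) : Set (Fin I × Fin J)).PairwiseDisjoint
      S := by
    intro q _ q' _ hne
    refine Finset.disjoint_left.2 fun y hy hy' => hne ?_
    simp only [S, Finset.mem_inter, mem_image_perm_iff] at hy hy'
    exact Prod.ext (blockF_index_unique hy.1 hy'.1) (blockF_index_unique hy.2 hy'.2)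
  have hcard : (Finset.univ.biUnion S).card = Fintype.card (Fin n) := by
    rw [Finset.card_biUnion hdisj, Fintype.card_fin, Fintype.sum_prod_type]
    exact hsum
  have hx : x ∈ Finset.univ.biUnion S := by
    rw [(Finset.card_eq_iff_eq_univ _).1 hcard]
    exact Finset.mem_univ x
  obtain ⟨q, -, hq⟩ := Finset.mem_biUnion.1 hx
  simp only [S, Finset.mem_inter, mem_image_perm_iff] at hq
  exact ⟨q.1, q.2, hq⟩

/-- The stabilizer is the product of the symmetric groups of the sets `L_i ∩ σ(M_j)`, compatibly
with cycle counts. -/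
lemma exists_stabilizer_equiv {n I J : ℕ} {lam : Fin I → ℕ} {mu : Fin J → ℕ}
    {σ : Equiv.Perm (Fin n)} {T : Fin I → Fin J → ℕ} (hσ : tab n lam mu σ = T)
    (hsum : ∑ i, ∑ j, T i j = n) :
    ∃ E : {p : Equiv.Perm (Fin n) × Equiv.Perm (Fin n) //
          p.1 ∈ young n lam ∧ p.2 ∈ young n mu ∧ p.1⁻¹ * σ * p.2 = σ} ≃
        ∀ q : Fin I × Fin J, Equiv.Perm (Fin (T q.1 q.2)),
      ∀ p l i j, meetCycCount n lam mu σ p.1.1 l i j = cycCount (E p (i, j)) l := by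
  have hcov := exists_mem_meet (lam := lam) (mu := mu) (σ := σ) (by rw [hσ, hsum])
  choose a b hab using hcov
  have ha (x i) : x ∈ blockF n lam i ↔ a x = i :=
    ⟨fun hx => blockF_index_unique (hab x).1 hx, fun hx => hx ▸ (hab x).1⟩
  have hb (x j) : x ∈ blockF n mu j ↔ b (σ x) = j := by
    have hx' := (hab (σ x)).2
    rw [← Equiv.Perm.mul_apply, inv_mul_cancel, Equiv.Perm.one_apply] at hx'
    exact ⟨fun hx => blockF_index_unique hx' hx, fun hx => hx ▸ hx'⟩
  let c : Fin n → Fin I × Fin J := fun x => (a x, b x)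
  have hmem (q : Fin I × Fin J) (x : Fin n) :
      x ∈ blockF n lam q.1 ∩ (blockF n mu q.2).image ⇑σ ↔ c x = q := by
    rw [Finset.mem_inter, mem_image_perm_iff, ha, hb, ← Equiv.Perm.mul_apply, mul_inv_cancel, Equiv.Perm.one_apply,
      Prod.ext_iff]
  have hfib (q : Fin I × Fin J) : Fintype.card {x // c x = q} = T q.1 q.2 := by
    rw [← hσ, tab]
    exact Fintype.card_of_subtype _ (hmem q)
  let e (q : Fin I × Fin J) : {x // c x = q} ≃ Fin (T q.1 q.2) := Fintype.equivFinOfCardEq (hfib q)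
  have hconj (p : Equiv.Perm (Fin n) × Equiv.Perm (Fin n)) :
      p.1⁻¹ * σ * p.2 = σ ↔ p.2 = σ⁻¹ * p.1 * σ := by
    rw [mul_assoc, inv_mul_eq_iff_eq_mul, mul_assoc, eq_inv_mul_iff_mul_eq]
  have hstab (h : Equiv.Perm (Fin n)) :
      (h ∈ young n lam ∧ σ⁻¹ * h * σ ∈ young n mu) ↔ ∀ x, c (h x) = c x := by
    rw [mem_young_iff ha, mem_young_iff hb]
    have hσh (x) : σ ((σ⁻¹ * h * σ) x) = h (σ x) := by simp
    simp only [c, Prod.ext_iff, forall_and, hσh]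
    exact and_congr_right fun _ => σ.forall_congr_right (q := fun x => b (h x) = b x)
  let E₁ : {p : Equiv.Perm (Fin n) × Equiv.Perm (Fin n) //
      p.1 ∈ young n lam ∧ p.2 ∈ young n mu ∧ p.1⁻¹ * σ * p.2 = σ} ≃
      {h : Equiv.Perm (Fin n) // ∀ x, c (h x) = c x} :=
    { toFun p := ⟨p.1.1, (hstab _).1 ⟨p.2.1, (hconj _).1 p.2.2.2 ▸ p.2.2.1⟩⟩
      invFun h := ⟨(h.1, σ⁻¹ * h.1 * σ), ((hstab _).2 h.2).1, ((hstab _).2 h.2).2,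
        (hconj _).2 rfl⟩
      left_inv p := Subtype.ext (Prod.ext rfl ((hconj _).1 p.2.2.2).symm)
      right_inv _ := rfl }
  refine ⟨E₁.trans ((permFiberEquiv c).trans (Equiv.piCongrRight fun q => (e q).permCongr)), ?_⟩
  intro p l i j
  refine card_permCycles_filter_subset (fun y => ((e (i, j)).symm y : Fin n)) ?_ ?_ ?_ l
  · intro y
    simp [E₁, permFiberEquiv, Equiv.permCongr_apply]
  · exact Subtype.val_injective.comp (e (i, j)).symm.injective
  · intro x
    rw [hmem (i, j)]
    exact ⟨fun hx => ⟨e (i, j) ⟨x, hx⟩, by simp⟩, fun ⟨y, hy⟩ => hy ▸ ((e (i, j)).symm y).2⟩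

/-- Fix `T ∈ T_{λ,μ}` and `σ ∈ S_n` with `f(σ) = T`, and let `(h,k)` be uniform on the
stabilizer `(S_λ × S_μ)_σ = {(h,k) : h⁻¹ σ k = σ}`.  Then the random vectors
`a_{i,j} = (a^{(l)}_{i,j})_{l≥1}` are mutually independent, and each `a_{i,j}` is
distributed as the cycle type of a uniformly random permutation of a set of size
`T_{i,j}`: the joint law is the product of these cycle-type laws. -/
theorem meet_cycles_cycle_type_indep (n I J : ℕ) (lam : Fin I → ℕ) (mu : Fin J → ℕ)
    (hlam : ∀ i, 0 < lam i) (hmu : ∀ j, 0 < mu j)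
    (hlamsum : ∑ i, lam i = n) (hmusum : ∑ j, mu j = n)
    (T : Fin I → Fin J → ℕ)
    (hT1 : ∀ i, ∑ j, T i j = lam i) (hT2 : ∀ j, ∑ i, T i j = mu j)
    (σ : Equiv.Perm (Fin n)) (hσ : tab n lam mu σ = T) :
    ∀ v : Fin I → Fin J → ℕ → ℕ,
      (Nat.card {p : Equiv.Perm (Fin n) × Equiv.Perm (Fin n) //
          p.1 ∈ young n lam ∧ p.2 ∈ young n mu ∧ p.1⁻¹ * σ * p.2 = σ ∧
            ∀ (i : Fin I) (j : Fin J),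
              (fun l => meetCycCount n lam mu σ p.1 l i j) = v i j} : ℚ)
        / (Nat.card {p : Equiv.Perm (Fin n) × Equiv.Perm (Fin n) //
            p.1 ∈ young n lam ∧ p.2 ∈ young n mu ∧ p.1⁻¹ * σ * p.2 = σ} : ℚ)
      = ∏ i : Fin I, ∏ j : Fin J,
          (Nat.card {π : Equiv.Perm (Fin (T i j)) // (fun l => cycCount π l) = v i j} : ℚ)
            / (Nat.factorial (T i j) : ℚ) := by
  intro v
  obtain ⟨E, hE⟩ := exists_stabilizer_equiv hσ (by simp only [hT1, hlamsum])
  have hden : Nat.card {p : Equiv.Perm (Fin n) × Equiv.Perm (Fin n) //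
      p.1 ∈ young n lam ∧ p.2 ∈ young n mu ∧ p.1⁻¹ * σ * p.2 = σ} =
      ∏ q : Fin I × Fin J, (T q.1 q.2).factorial := by
    rw [Nat.card_congr E, Nat.card_pi]
    simp only [Nat.card_perm, Nat.card_fin]
  have hnum : Nat.card {p : Equiv.Perm (Fin n) × Equiv.Perm (Fin n) //
      p.1 ∈ young n lam ∧ p.2 ∈ young n mu ∧ p.1⁻¹ * σ * p.2 = σ ∧
        ∀ (i : Fin I) (j : Fin J), (fun l => meetCycCount n lam mu σ p.1 l i j) = v i j} =
      ∏ q : Fin I × Fin J,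
        Nat.card {π : Equiv.Perm (Fin (T q.1 q.2)) // (fun l => cycCount π l) = v q.1 q.2} := by
    let Q (q : Fin I × Fin J) (π : Equiv.Perm (Fin (T q.1 q.2))) : Prop :=
      (fun l => cycCount π l) = v q.1 q.2
    let stab (p : Equiv.Perm (Fin n) × Equiv.Perm (Fin n)) : Prop :=
      p.1 ∈ young n lam ∧ p.2 ∈ young n mu ∧ p.1⁻¹ * σ * p.2 = σ
    let R (p : Equiv.Perm (Fin n) × Equiv.Perm (Fin n)) : Prop :=
      ∀ (i : Fin I) (j : Fin J), (fun l => meetCycCount n lam mu σ p.1 l i j) = v i j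
    have hER (p : {p // stab p}) : R p.1 ↔ ∀ q, Q q (E p q) := by
      simp only [R, Q, hE p, Prod.forall]
    calc
      _ = Nat.card {p // stab p ∧ R p} :=
        Nat.card_congr (Equiv.subtypeEquivRight fun p => by simp only [stab, R, and_assoc])
      _ = Nat.card {p : {p // stab p} // R p.1} :=
        Nat.card_congr (Equiv.subtypeSubtypeEquivSubtypeInter stab R).symm
      _ = Nat.card {g : ∀ q : Fin I × Fin J, Equiv.Perm (Fin (T q.1 q.2)) // ∀ q, Q q (g q)} :=
        Nat.card_congr (E.subtypeEquiv hER)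
      _ = Nat.card (∀ q, {π // Q q π}) :=
        Nat.card_congr (Equiv.subtypePiEquivPi
          (β := fun q : Fin I × Fin J => Equiv.Perm (Fin (T q.1 q.2))) (p := fun {q} => Q q))
      _ = _ := Nat.card_pi
  rw [hnum, hden, ← Fintype.prod_prod_type', Finset.prod_div_distrib]
  push_cast
  rfl
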